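/- Let μ be an isotropic log-concave probability measure on ℝ, and fix d ∈ ℕ. Then for every n ∈ ℕ and every polynomial f : ℝⁿ → ℝ of degree at most d, Var_{μ^⊗n}(f) ≥ 2^{−15d} · coeff_d(f)². -/

import Mathlib

open MeasureTheory

/-- The `d`-level content of a multivariate polynomial. -/
noncomputable def coeffd {n : ℕ} (d : ℕ) (f : MvPolynomial (Fin n) ℝ) : ℝ :=
  Real.sqrt (∑ m ∈ f.support.filter (fun m => (∑ i, m i) = d), f.coeff m ^ 2)

/-- A measure on `ℝ` is log-concave if it has a density `ρ` with respect to Lebesgue measure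
satisfying `ρ((1-l)x + ly) ≥ ρ(x)^(1-l) * ρ(y)^l`. -/
def IsLogConcaveMeasure (μ : Measure ℝ) : Prop :=
  ∃ ρ : ℝ → ℝ, (∀ x, 0 ≤ ρ x) ∧
    (∀ x y l : ℝ, 0 ≤ l → l ≤ 1 → ρ x ^ (1 - l) * ρ y ^ l ≤ ρ ((1 - l) * x + l * y)) ∧
    μ = volume.withDensity (fun x => ENNReal.ofReal (ρ x))

/-- A nonnegative function on `ℝ` satisfying the multiplicative concavity inequality. -/
structure IsLogConcaveFun (f : ℝ → ℝ) : Prop where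
  nonneg : ∀ x, 0 ≤ f x
  le_apply : ∀ x y l : ℝ, 0 ≤ l → l ≤ 1 → f x ^ (1 - l) * f y ^ l ≤ f ((1 - l) * x + l * y)

namespace IsLogConcaveFun

variable {f : ℝ → ℝ}

lemma min_le (hf : IsLogConcaveFun f) {x y l : ℝ} (h0 : 0 ≤ l) (h1 : l ≤ 1) :
    min (f x) (f y) ≤ f ((1 - l) * x + l * y) := by
  have hm : 0 ≤ min (f x) (f y) := _root_.le_min (hf.nonneg x) (hf.nonneg y)
  refine le_trans ?_ (hf.le_apply x y l h0 h1)
  calc min (f x) (f y) = min (f x) (f y) ^ ((1 - l) + l) := by simp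
    _ = min (f x) (f y) ^ (1 - l) * min (f x) (f y) ^ l := by
      rw [Real.rpow_add_of_nonneg hm (by linarith) h0]
    _ ≤ f x ^ (1 - l) * f y ^ l := by
      have := hf.nonneg x
      have := hf.nonneg y
      have : 0 ≤ 1 - l := sub_nonneg.2 h1
      gcongr
      · exact min_le_left _ _
      · exact min_le_right _ _

lemma measurable (hf : IsLogConcaveFun f) : Measurable f := by
  refine measurable_of_Ici fun a => ?_
  refine Set.OrdConnected.measurableSet (Convex.ordConnected ?_)
  intro x hx y hy s t hs ht hst
  obtain rfl : s = 1 - t := by linarith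
  simp only [Set.mem_preimage, Set.mem_Ici, smul_eq_mul] at *
  exact le_trans (le_min hx hy) (hf.min_le ht (by linarith))

lemma comp_add_left (hf : IsLogConcaveFun f) (a : ℝ) : IsLogConcaveFun fun t => f (a + t) where
  nonneg _ := hf.nonneg _
  le_apply x y l h0 h1 := by
    convert hf.le_apply (a + x) (a + y) l h0 h1 using 2
    ring

lemma comp_sub_left (hf : IsLogConcaveFun f) (a : ℝ) : IsLogConcaveFun fun t => f (a - t) where
  nonneg _ := hf.nonneg _
  le_apply x y l h0 h1 := by
    convert hf.le_apply (a - x) (a - y) l h0 h1 using 2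
    ring

end IsLogConcaveFun

lemma integrableOn_pow_mul_exp_neg_mul {c : ℝ} (hc : 0 < c) (k : ℕ) :
    IntegrableOn (fun t : ℝ => t ^ k * Real.exp (-(c * t))) (Set.Ioi 0) := by
  have h := integrableOn_rpow_mul_exp_neg_mul_rpow (p := 1) (s := k) (b := c)
    (by have : (0 : ℝ) ≤ k := Nat.cast_nonneg k
        linarith) one_pos hc
  simpa using h

lemma integral_sq_mul_exp_neg_mul {c : ℝ} (hc : 0 < c) :
    ∫ t in Set.Ioi (0 : ℝ), t ^ 2 * Real.exp (-(c * t)) = 2 / c ^ 3 := by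
  have h := Real.integral_rpow_mul_exp_neg_mul_Ioi (a := 3) (r := c) (by norm_num) hc
  have hG : Real.Gamma 3 = 2 := by
    have := Real.Gamma_nat_eq_factorial 2
    rw [show ((2 : ℕ) : ℝ) + 1 = 3 by norm_num] at this
    rw [this]
    norm_num
  rw [hG] at h
  norm_num at h
  rw [h]
  ring

lemma integral_exp_neg_mul_Ioi {c : ℝ} (hc : 0 < c) :
    ∫ t in Set.Ioi (0 : ℝ), Real.exp (-(c * t)) = 1 / c := by
  have h := integral_exp_mul_Ioi (a := -c) (by linarith) 0
  simpa [neg_div_neg_eq] using h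

namespace IsLogConcaveFun

variable {f : ℝ → ℝ}

/-- A log-concave function with small mass on the half-line crosses the exponential
`f 0 * exp (-c t)` at a single point. -/
lemma exists_crossing (hf : IsLogConcaveFun f) (hint : IntegrableOn f (Set.Ioi 0)) {c : ℝ}
    (hc : 0 < c) (hpos : 0 < f 0) (hlt : ∫ t in Set.Ioi 0, f t < f 0 / c) :
    ∃ s, 0 ≤ s ∧ (∀ t, 0 ≤ t → t < s → f 0 * Real.exp (-(c * t)) ≤ f t) ∧
      ∀ t, s < t → f t ≤ f 0 * Real.exp (-(c * t)) := by
  set S : Set ℝ := {t | 0 ≤ t ∧ f 0 * Real.exp (-(c * t)) ≤ f t} with hS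
  have h0 : (0 : ℝ) ∈ S := by simp [hS]
  have hdown : ∀ t ∈ S, ∀ u, 0 ≤ u → u ≤ t → u ∈ S := by
    rintro t ⟨ht0, ht⟩ u hu hut
    refine ⟨hu, ?_⟩
    rcases eq_or_lt_of_le ht0 with h | htpos
    · obtain rfl : u = 0 := by linarith
      simp
    set l := u / t with hl
    have hl0 : 0 ≤ l := by positivity
    have hl1 : l ≤ 1 := by rw [hl, div_le_one htpos]; exact hut
    have hlt : l * t = u := by rw [hl]; field_simp
    have key := hf.le_apply 0 t l hl0 hl1
    rw [mul_zero, zero_add, hlt] at key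
    refine le_trans ?_ key
    calc f 0 * Real.exp (-(c * u))
        = f 0 ^ (1 - l) * (f 0 * Real.exp (-(c * t))) ^ l := by
          rw [Real.mul_rpow hpos.le (Real.exp_pos _).le, ← Real.exp_mul, ← mul_assoc,
            ← Real.rpow_add hpos, ← hlt]
          simp only [sub_add_cancel, Real.rpow_one]
          ring_nf
      _ ≤ f 0 ^ (1 - l) * f t ^ l := by gcongr
  have hbdd : BddAbove S := by
    by_contra hb
    have hall : ∀ u, 0 ≤ u → u ∈ S := by
      intro u hu
      rw [not_bddAbove_iff] at hb
      obtain ⟨t, htS, hut⟩ := hb u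
      exact hdown t htS u hu hut.le
    have hle : ∫ t in Set.Ioi (0 : ℝ), f 0 * Real.exp (-(c * t)) ≤ ∫ t in Set.Ioi 0, f t := by
      refine setIntegral_mono_on ?_ hint measurableSet_Ioi fun t ht => (hall t (le_of_lt ht)).2
      have h := (integrableOn_pow_mul_exp_neg_mul hc 0).const_mul (f 0)
      simp only [pow_zero, one_mul] at h
      exact h
    rw [integral_const_mul, integral_exp_neg_mul_Ioi hc] at hle
    have : f 0 * (1 / c) = f 0 / c := by ring
    linarith
  refine ⟨sSup S, le_csSup hbdd h0, fun t ht hts => ?_, fun t hts => ?_⟩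
  · obtain ⟨u, huS, htu⟩ := exists_lt_of_lt_csSup ⟨0, h0⟩ hts
    exact (hdown u huS t ht htu.le).2
  · by_contra! hcon
    have : t ∈ S := ⟨(le_csSup hbdd h0).trans hts.le, hcon.le⟩
    exact absurd (le_csSup hbdd this) (not_le.2 hts)

lemma integrableOn_pow_mul (hf : IsLogConcaveFun f) (hint : IntegrableOn f (Set.Ioi 0))
    (hpos : 0 < f 0) (k : ℕ) : IntegrableOn (fun t => t ^ k * f t) (Set.Ioi 0) := by
  have hI : 0 ≤ ∫ t in Set.Ioi 0, f t := integral_nonneg hf.nonneg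
  set c := f 0 / ((∫ t in Set.Ioi 0, f t) + 1) with hcdef
  have hc : 0 < c := by positivity
  obtain ⟨s, hs0, -, hs⟩ := hf.exists_crossing hint hc hpos (by
    rw [hcdef, div_div_cancel₀ hpos.ne']; linarith)
  have hg : IntegrableOn (fun t : ℝ => s ^ k * f t + f 0 * (t ^ k * Real.exp (-(c * t))))
      (Set.Ioi 0) := (hint.const_mul _).add ((integrableOn_pow_mul_exp_neg_mul hc k).const_mul _)
  refine Integrable.mono' hg
    (((measurable_id.pow_const k).mul hf.measurable).aestronglyMeasurable) ?_
  filter_upwards [ae_restrict_mem measurableSet_Ioi] with t ht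
  have ht' : (0 : ℝ) < t := ht
  have hft := hf.nonneg t
  rw [Real.norm_of_nonneg (mul_nonneg (by positivity) hft)]
  rcases le_or_gt t s with h | h
  · have h1 : t ^ k * f t ≤ s ^ k * f t := by gcongr
    have : 0 ≤ f 0 * (t ^ k * Real.exp (-(c * t))) := by positivity
    linarith
  · have h1 : t ^ k * f t ≤ t ^ k * (f 0 * Real.exp (-(c * t))) := by
      gcongr
      exact hs t h
    have : 0 ≤ s ^ k * f t := by positivity
    linarith

lemma integral_sq_mul_le (hf : IsLogConcaveFun f) (hint : IntegrableOn f (Set.Ioi 0)) {c : ℝ}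
    (hc : 0 < c) (hpos : 0 < f 0) (hlt : ∫ t in Set.Ioi 0, f t < f 0 / c) :
    ∫ t in Set.Ioi 0, t ^ 2 * f t ≤ 2 * f 0 / c ^ 3 := by
  obtain ⟨s, hs0, hs1, hs2⟩ := hf.exists_crossing hint hc hpos hlt
  have i1 := (integrableOn_pow_mul_exp_neg_mul hc 2).const_mul (f 0)
  have i0 : IntegrableOn (fun t : ℝ => Real.exp (-(c * t))) (Set.Ioi 0) := by
    simpa using integrableOn_pow_mul_exp_neg_mul hc 0
  have i2 := i0.const_mul (s ^ 2 * f 0)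
  have i3 := hint.const_mul (s ^ 2)
  have hle : ∫ t in Set.Ioi 0, t ^ 2 * f t ≤
      ∫ t in Set.Ioi 0, ((f 0 * (t ^ 2 * Real.exp (-(c * t))) + s ^ 2 * f t) -
        s ^ 2 * f 0 * Real.exp (-(c * t))) := by
    refine setIntegral_mono_on (hf.integrableOn_pow_mul hint hpos 2) ((i1.add i3).sub i2)
      measurableSet_Ioi fun t ht => ?_
    have ht' : (0 : ℝ) < t := ht
    have key : (t ^ 2 - s ^ 2) * (f t - f 0 * Real.exp (-(c * t))) ≤ 0 := by
      rcases lt_trichotomy t s with h | h | h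
      · exact mul_nonpos_of_nonpos_of_nonneg (by nlinarith) (by linarith [hs1 t ht'.le h])
      · simp [h]
      · exact mul_nonpos_of_nonneg_of_nonpos (by nlinarith) (by linarith [hs2 t h])
    linarith
  rw [integral_sub (by exact i1.add i3) i2, integral_add i1 i3, integral_const_mul, integral_const_mul,
    integral_const_mul, integral_exp_neg_mul_Ioi hc, integral_sq_mul_exp_neg_mul hc] at hle
  have h1 : s ^ 2 * (∫ t in Set.Ioi 0, f t) ≤ s ^ 2 * (f 0 / c) := by gcongr
  have h2 : f 0 * (2 / c ^ 3) = 2 * f 0 / c ^ 3 := by ring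
  have h3 : s ^ 2 * f 0 * (1 / c) = s ^ 2 * (f 0 / c) := by ring
  linarith

lemma integrable_sub_pow_mul (hf : IsLogConcaveFun f) (hint : Integrable f) {a : ℝ}
    (hpos : 0 < f a) (k : ℕ) : Integrable fun x => (x - a) ^ k * f x := by
  have hr := (hf.comp_add_left a).integrableOn_pow_mul (hint.comp_add_left a).integrableOn
    (by simpa using hpos) k
  have hl := (hf.comp_sub_left a).integrableOn_pow_mul (hint.comp_sub_left a).integrableOn
    (by simpa using hpos) k
  have hr' : IntegrableOn (fun x => (x - a) ^ k * f x) (Set.Ioi a) := by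
    rw [← (measurePreserving_add_left volume a).integrableOn_comp_preimage
      (measurableEmbedding_addLeft a)]
    convert hr using 1
    · ext t; simp
    · ext t; simp
  have hl' : IntegrableOn (fun x => (x - a) ^ k * f x) (Set.Iio a) := by
    rw [← (Measure.measurePreserving_sub_left volume a).integrableOn_comp_preimage
      (MeasurableEquiv.subLeft a).measurableEmbedding]
    have h : IntegrableOn (fun t => (-1) ^ k * (t ^ k * f (a - t))) (Set.Ioi 0) :=
      hl.const_mul ((-1) ^ k)
    convert h using 1
    · ext t
      simp only [Function.comp, sub_sub_cancel_left]
      rw [neg_pow]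
      ring
    · ext t; simp
  rw [← integrableOn_univ, ← Set.Iic_union_Ioi (a := a)]
  exact ((integrableOn_Iic_iff_integrableOn_Iio enorm_ne_top).2 hl').union hr'

lemma integral_sub_sq_mul_le (hf : IsLogConcaveFun f) (hint : Integrable f)
    (h1 : ∫ x, f x = 1) {a : ℝ} (hpos : 0 < f a) :
    ∫ x, (x - a) ^ 2 * f x ≤ 6 / f a ^ 2 := by
  have hr := (hf.comp_add_left a).integral_sq_mul_le (hint.comp_add_left a).integrableOn
    (c := f a / (11 / 10)) (by positivity) (by simpa using hpos) (by
      have : ∫ t in Set.Ioi 0, f (a + t) ≤ ∫ t, f (a + t) :=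
        setIntegral_le_integral (hint.comp_add_left a) (Filter.Eventually.of_forall fun _ =>
          hf.nonneg _)
      rw [integral_add_left_eq_self (μ := volume) f a, h1] at this
      rw [add_zero, div_div_cancel₀ hpos.ne']
      linarith)
  have hl := (hf.comp_sub_left a).integral_sq_mul_le (hint.comp_sub_left a).integrableOn
    (c := f a / (11 / 10)) (by positivity) (by simpa using hpos) (by
      have : ∫ t in Set.Ioi 0, f (a - t) ≤ ∫ t, f (a - t) :=
        setIntegral_le_integral (hint.comp_sub_left a) (Filter.Eventually.of_forall fun _ =>
          hf.nonneg _)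
      rw [integral_sub_left_eq_self f volume a, h1] at this
      rw [sub_zero, div_div_cancel₀ hpos.ne']
      linarith)
  have hr' : ∫ t in Set.Ioi 0, t ^ 2 * f (a + t) = ∫ x in Set.Ioi a, (x - a) ^ 2 * f x := by
    have h := (measurePreserving_add_left volume a).setIntegral_preimage_emb
      (measurableEmbedding_addLeft a) (fun x => (x - a) ^ 2 * f x) (Set.Ioi a)
    simpa using h
  have hl' : ∫ t in Set.Ioi 0, t ^ 2 * f (a - t) = ∫ x in Set.Iio a, (x - a) ^ 2 * f x := by
    have h := (Measure.measurePreserving_sub_left volume a).setIntegral_preimage_emb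
      (MeasurableEquiv.subLeft a).measurableEmbedding (fun x => (x - a) ^ 2 * f x) (Set.Iio a)
    simpa using h
  have hi := hf.integrable_sub_pow_mul hint hpos 2
  rw [← setIntegral_univ, ← Set.Iic_union_Ioi (a := a),
    setIntegral_union (Set.Iic_disjoint_Ioi le_rfl) measurableSet_Ioi hi.integrableOn
      hi.integrableOn, integral_Iic_eq_integral_Iio, ← hr', ← hl']
  rw [add_zero] at hr
  rw [sub_zero] at hl
  have h2 : 2 * f a / (f a / (11 / 10)) ^ 3 = 2 * (11 / 10) ^ 3 / f a ^ 2 := by field_simp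
  have h3 : 2 * (11 / 10 : ℝ) ^ 3 / f a ^ 2 + 2 * (11 / 10) ^ 3 / f a ^ 2 ≤ 6 / f a ^ 2 := by
    rw [← add_div]
    gcongr
    norm_num
  rw [h2] at hr hl
  linarith

end IsLogConcaveFun
section OneDimensional

variable {μ : Measure ℝ}

/-- The negative part of `log |x|`, as an integrable function. -/
noncomputable def truncLog : ℝ → ℝ := (Set.Ioc (-1) 1).indicator Real.log

lemma integrable_truncLog : Integrable truncLog := by
  rw [truncLog, integrable_indicator_iff measurableSet_Ioc,
    ← intervalIntegrable_iff_integrableOn_Ioc_of_le (by norm_num)]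
  exact intervalIntegral.intervalIntegrable_log'

lemma integral_truncLog : ∫ x, truncLog x = -2 := by
  rw [truncLog, integral_indicator measurableSet_Ioc,
    ← intervalIntegral.integral_of_le (by norm_num), integral_log]
  norm_num

lemma truncLog_nonpos (x : ℝ) : truncLog x ≤ 0 := by
  refine Set.indicator_nonpos (fun y hy => ?_) x
  rw [← Real.log_abs]
  exact Real.log_nonpos (abs_nonneg _) (abs_le.2 ⟨hy.1.le, hy.2⟩)

lemma exp_truncLog_le {x : ℝ} (hx : x ≠ 0) : Real.exp (truncLog x) ≤ |x| := by
  by_cases h : x ∈ Set.Ioc (-1 : ℝ) 1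
  · rw [truncLog, Set.indicator_of_mem h, Real.exp_log_eq_abs hx]
  · rw [truncLog, Set.indicator_of_notMem h, Real.exp_zero, le_abs]
    simp only [Set.mem_Ioc, not_and_or, not_lt, not_le] at h
    rcases h with h | h
    · right; linarith
    · left; linarith

lemma integrable_truncLog_sub (hμ : μ ≤ ENNReal.ofReal (5 / 2) • (volume : Measure ℝ)) (a : ℝ) :
    Integrable (fun x => truncLog (x - a)) μ :=
  ((integrable_truncLog.comp_sub_right a).smul_measure ENNReal.ofReal_ne_top).mono_measure hμ

lemma integral_truncLog_sub_ge (hμ : μ ≤ ENNReal.ofReal (5 / 2) • (volume : Measure ℝ)) (a : ℝ) :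
    -5 ≤ ∫ x, truncLog (x - a) ∂μ := by
  have h := integral_mono_measure (f := fun x => -truncLog (x - a)) hμ
    (Filter.Eventually.of_forall fun x => neg_nonneg.2 (truncLog_nonpos _))
    ((integrable_truncLog.comp_sub_right a).neg.smul_measure ENNReal.ofReal_ne_top)
  rw [integral_neg, integral_smul_measure, integral_neg,
    integral_sub_right_eq_self (μ := volume) truncLog a, integral_truncLog,
    ENNReal.toReal_ofReal (by norm_num)] at h
  norm_num at h
  linarith

lemma exists_exp_le_prod_abs_sub (hμ : μ ≤ ENNReal.ofReal (5 / 2) • (volume : Measure ℝ))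
    (s : Multiset ℝ) : ∃ Y : ℝ → ℝ, Integrable Y μ ∧ -5 * (Multiset.card s : ℝ) ≤ ∫ x, Y x ∂μ ∧
      ∀ᵐ x ∂μ, Real.exp (Y x) ≤ (s.map fun a => |x - a|).prod := by
  induction s using Multiset.induction_on with
  | empty => exact ⟨0, integrable_zero _ _ _, by simp, by simp⟩
  | cons a s ih =>
    obtain ⟨Y, hY, hYi, hYe⟩ := ih
    have ha := integrable_truncLog_sub hμ a
    refine ⟨fun x => truncLog (x - a) + Y x, ha.add hY, ?_, ?_⟩
    · rw [integral_add ha hY]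
      have := integral_truncLog_sub_ge hμ a
      push_cast [Multiset.card_cons]
      linarith
    · have hne : ∀ᵐ x ∂μ, x ≠ a := by
        refine (Measure.absolutelyContinuous_of_le hμ).ae_le
          ((Measure.smul_absolutelyContinuous).ae_le ?_)
        exact compl_mem_ae_iff.2 (measure_singleton a)
      filter_upwards [hYe, hne] with x hx hxa
      rw [Real.exp_add, Multiset.map_cons, Multiset.prod_cons]
      exact mul_le_mul (exp_truncLog_le (sub_ne_zero.2 hxa)) hx (Real.exp_pos _).le (abs_nonneg _)

lemma Polynomial.Monic.exists_prod_abs_sub_le {p : Polynomial ℝ} (hp : p.Monic) :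
    ∃ s : Multiset ℝ, Multiset.card s = p.natDegree ∧
      ∀ x, (s.map fun a => |x - a|).prod ≤ |p.eval x| := by
  set q := p.map (algebraMap ℝ ℂ) with hq
  have hqm : q.Monic := hp.map _
  have hs : q.Splits := IsAlgClosed.splits q
  refine ⟨q.roots.map Complex.re, ?_, fun x => ?_⟩
  · rw [Multiset.card_map, ← hs.natDegree_eq_card_roots, hq, Polynomial.natDegree_map]
  · have h1 : |p.eval x| = ‖q.eval (x : ℂ)‖ := by
      rw [hq, ← Complex.coe_algebraMap, Polynomial.eval_map_algebraMap,
        Polynomial.aeval_algebraMap_apply]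
      simp
    have h2 (t : Multiset ℂ) : ‖t.prod‖ = (t.map norm).prod :=
      map_multiset_prod (normHom : ℂ →*₀ ℝ) t
    rw [h1, hs.eval_eq_prod_roots_of_monic hqm, h2, Multiset.map_map, Multiset.map_map]
    refine Multiset.prod_map_le_prod_map₀ _ _ (fun _ _ => abs_nonneg _) fun z _ => ?_
    simpa using Complex.abs_re_le_norm ((x : ℂ) - z)

variable [IsProbabilityMeasure μ]

lemma IsLogConcaveMeasure.exists_density (hlc : IsLogConcaveMeasure μ) :
    ∃ ρ : ℝ → ℝ, IsLogConcaveFun ρ ∧ Integrable ρ ∧ ∫ x, ρ x = 1 ∧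
      μ = volume.withDensity (fun x => ENNReal.ofReal (ρ x)) := by
  obtain ⟨ρ, h0, h1, rfl⟩ := hlc
  have hρ : IsLogConcaveFun ρ := ⟨h0, h1⟩
  have hm := hρ.measurable
  have hmass : ∫⁻ x, ENNReal.ofReal (ρ x) = 1 := by
    have := measure_univ (μ := volume.withDensity (fun x => ENNReal.ofReal (ρ x)))
    rwa [withDensity_apply _ MeasurableSet.univ, Measure.restrict_univ] at this
  refine ⟨ρ, hρ, ⟨hm.aestronglyMeasurable, ?_⟩, ?_, rfl⟩
  · rw [hasFiniteIntegral_iff_ofReal (Filter.Eventually.of_forall h0), hmass]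
    exact ENNReal.one_lt_top
  · rw [integral_eq_lintegral_of_nonneg_ae (Filter.Eventually.of_forall h0)
      hm.aestronglyMeasurable, hmass, ENNReal.toReal_one]

lemma integral_withDensity_ofReal {ρ : ℝ → ℝ} (hρ : IsLogConcaveFun ρ) (g : ℝ → ℝ) :
    ∫ x, g x ∂(volume.withDensity fun x => ENNReal.ofReal (ρ x)) = ∫ x, g x * ρ x := by
  rw [integral_withDensity_eq_integral_toReal_smul hρ.measurable.ennreal_ofReal
    (Filter.Eventually.of_forall fun _ => ENNReal.ofReal_lt_top)]
  simp [ENNReal.toReal_ofReal (hρ.nonneg _), mul_comm]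

lemma integrable_withDensity_ofReal_iff {ρ : ℝ → ℝ} (hρ : IsLogConcaveFun ρ) {g : ℝ → ℝ} :
    Integrable g (volume.withDensity fun x => ENNReal.ofReal (ρ x)) ↔
      Integrable fun x => g x * ρ x := by
  rw [integrable_withDensity_iff hρ.measurable.ennreal_ofReal
    (Filter.Eventually.of_forall fun _ => ENNReal.ofReal_lt_top)]
  simp [ENNReal.toReal_ofReal (hρ.nonneg _)]

/-- Log-concave probability measures have moments of all orders. -/
lemma IsLogConcaveMeasure.integrable_pow (hlc : IsLogConcaveMeasure μ) (k : ℕ) :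
    Integrable (fun x => x ^ k) μ := by
  obtain ⟨ρ, hρ, hint, h1, rfl⟩ := hlc.exists_density
  obtain ⟨a, ha⟩ : ∃ a, 0 < ρ a := by
    by_contra! h
    have : ρ = 0 := funext fun x => le_antisymm (h x) (hρ.nonneg x)
    simp [this] at h1
  have hpow (j : ℕ) : Integrable (fun x => (x - a) ^ j)
      (volume.withDensity fun x => ENNReal.ofReal (ρ x)) :=
    (integrable_withDensity_ofReal_iff hρ).2 (hρ.integrable_sub_pow_mul hint ha j)
  have hexp : (fun x : ℝ => x ^ k) =
      fun x => ∑ m ∈ Finset.range (k + 1), (x - a) ^ m * a ^ (k - m) * (k.choose m) := by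
    ext x
    rw [← add_pow, sub_add_cancel]
  rw [hexp]
  exact integrable_finsetSum _ fun m _ => ((hpow m).mul_const _).mul_const _

/-- The density of an isotropic log-concave measure is at most `5 / 2`. -/
lemma IsLogConcaveMeasure.le_smul_volume (hlc : IsLogConcaveMeasure μ)
    (hmean : ∫ x, x ∂μ = 0) (hvar : ∫ x, x ^ 2 ∂μ = 1) :
    μ ≤ ENNReal.ofReal (5 / 2) • (volume : Measure ℝ) := by
  have i2 := hlc.integrable_pow 2
  have i1 := hlc.integrable_pow 1
  obtain ⟨ρ, hρ, hint, h1, rfl⟩ := hlc.exists_density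
  rw [← withDensity_const]
  refine withDensity_mono (Filter.Eventually.of_forall fun a => ENNReal.ofReal_le_ofReal ?_)
  by_contra! hlt
  have ha : 0 < ρ a := by linarith
  have hle := hρ.integral_sub_sq_mul_le hint h1 ha
  rw [← integral_withDensity_ofReal hρ] at hle
  have hexp : ∫ x, (x - a) ^ 2 ∂(volume.withDensity fun x => ENNReal.ofReal (ρ x)) =
      1 + a ^ 2 := by
    have : (fun x : ℝ => (x - a) ^ 2) = fun x => (x ^ 2 - 2 * a * x ^ 1) + a ^ 2 := by
      ext x; ring
    rw [this, integral_add (by exact i2.sub (i1.const_mul _)) (integrable_const _),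
      integral_sub i2 (i1.const_mul _), integral_const_mul, hvar]
    simp [hmean]
  rw [hexp, le_div_iff₀ (by positivity)] at hle
  nlinarith [sq_nonneg a, mul_nonneg (sq_nonneg a) (sq_nonneg (ρ a))]

lemma IsLogConcaveMeasure.integrable_eval (hlc : IsLogConcaveMeasure μ) (p : Polynomial ℝ) :
    Integrable (fun x => p.eval x) μ := by
  simp only [Polynomial.eval_eq_sum_range]
  exact integrable_finsetSum _ fun i _ => (hlc.integrable_pow i).const_mul _

/-- Monic polynomials have `L²` norm bounded below. -/
lemma Polynomial.Monic.le_integral_sq {p : Polynomial ℝ} (hp : p.Monic)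
    (hlc : IsLogConcaveMeasure μ) (hmean : ∫ x, x ∂μ = 0) (hvar : ∫ x, x ^ 2 ∂μ = 1) :
    (1 / 2 ^ 15 : ℝ) ^ p.natDegree ≤ ∫ x, p.eval x ^ 2 ∂μ := by
  have hμ := hlc.le_smul_volume hmean hvar
  obtain ⟨s, hs, hle⟩ := hp.exists_prod_abs_sub_le
  obtain ⟨Y, hY, hYi, hYe⟩ := exists_exp_le_prod_abs_sub hμ s
  set c := 2 * ∫ x, Y x ∂μ with hc
  have hI : Integrable (fun x => Real.exp c * (1 + (2 * Y x - c))) μ :=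
    ((integrable_const 1).add ((hY.const_mul 2).sub (integrable_const c))).const_mul _
  have hJ : Integrable (fun x => p.eval x ^ 2) μ := by
    have h := hlc.integrable_eval (p ^ 2)
    simpa only [Polynomial.eval_pow] using h
  have h1 : Real.exp c ≤ ∫ x, p.eval x ^ 2 ∂μ := by
    calc Real.exp c = ∫ x, Real.exp c * (1 + (2 * Y x - c)) ∂μ := by
          rw [integral_const_mul, integral_add (integrable_const _)
            (by exact (hY.const_mul 2).sub (integrable_const c)),
            integral_sub (hY.const_mul 2) (integrable_const c), integral_const_mul]
          simp [hc]
      _ ≤ _ := by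
          refine integral_mono_ae hI hJ ?_
          filter_upwards [hYe] with x hx
          have h2 : Real.exp (Y x) ≤ |p.eval x| := hx.trans (hle x)
          calc Real.exp c * (1 + (2 * Y x - c)) ≤ Real.exp c * Real.exp (2 * Y x - c) := by
                gcongr
                linarith [Real.add_one_le_exp (2 * Y x - c)]
            _ = Real.exp (Y x) ^ 2 := by
                rw [← Real.exp_add, ← Real.exp_nat_mul]
                congr 1
                push_cast
                ring
            _ ≤ |p.eval x| ^ 2 := by gcongr
            _ = _ := sq_abs _
  refine le_trans ?_ h1
  have h10 : (1 / 2 ^ 15 : ℝ) ≤ Real.exp (-10) := by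
    rw [← Real.log_le_iff_le_exp (by positivity), Real.log_div one_ne_zero (by positivity),
      Real.log_pow, Real.log_one]
    have := Real.log_two_gt_d9
    push_cast
    linarith
  calc (1 / 2 ^ 15 : ℝ) ^ p.natDegree ≤ Real.exp (-10) ^ p.natDegree := by gcongr
    _ = Real.exp (p.natDegree * -10) := (Real.exp_nat_mul _ _).symm
    _ ≤ Real.exp c := by
      rw [hs] at hYi
      gcongr
      linarith

end OneDimensional
section OrthogonalPolynomials

open Polynomial

variable {μ : Measure ℝ}

/-- Expectation of univariate polynomials, as a linear functional. -/
noncomputable def polynomialExpectation (hμ : ∀ p : ℝ[X], Integrable (fun x => p.eval x) μ) :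
    ℝ[X] →ₗ[ℝ] ℝ where
  toFun p := ∫ x, p.eval x ∂μ
  map_add' p q := by simp only [eval_add, integral_add (hμ p) (hμ q)]
  map_smul' c p := by simp [integral_const_mul]

lemma exists_monic_orthogonal (hμ : ∀ p : ℝ[X], Integrable (fun x => p.eval x) μ)
    (hpos : ∀ p : ℝ[X], p.Monic → 0 < ∫ x, p.eval x ^ 2 ∂μ) (k : ℕ) :
    ∃ p : ℝ[X], p.Monic ∧ p.natDegree = k ∧
      ∀ r : ℝ[X], r.degree < k → ∫ x, r.eval x * p.eval x ∂μ = 0 := by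
  set L := polynomialExpectation hμ
  have hLapp (p : ℝ[X]) : L p = ∫ x, p.eval x ∂μ := rfl
  set B := (LinearMap.mul ℝ ℝ[X]).compr₂ L
  set V := degreeLT ℝ k
  have : FiniteDimensional ℝ V :=
    Module.Finite.equiv (degreeLTEquiv ℝ k).symm
  set T : V →ₗ[ℝ] Module.Dual ℝ V := B.domRestrict₁₂ V V
  have hinj : Function.Injective T := by
    rw [injective_iff_map_eq_zero]
    intro r hr
    by_contra hne
    have hne' : (r : ℝ[X]) ≠ 0 := fun h => hne (Subtype.ext h)
    have h0 : L ((r : ℝ[X]) * r) = 0 := by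
      have := congrArg (fun φ : Module.Dual ℝ V => φ r) hr
      exact this
    have hm := hpos _ (monic_mul_leadingCoeff_inv hne')
    have hl : (r : ℝ[X]).leadingCoeff⁻¹ ≠ 0 := inv_ne_zero (leadingCoeff_ne_zero.2 hne')
    rw [hLapp] at h0
    simp only [eval_mul, eval_C, mul_pow, integral_mul_const] at hm h0
    simp only [← sq] at h0
    rw [h0] at hm
    simp at hm
  have hsurj := (LinearMap.injective_iff_surjective_of_finrank_eq_finrank
    (Subspace.dual_finrank_eq (K := ℝ) (V := V)).symm).1 hinj
  obtain ⟨q, hq⟩ := hsurj ((B (X ^ k)).domRestrict V)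
  have hqd : (q : ℝ[X]).degree < k := mem_degreeLT.1 q.2
  refine ⟨X ^ k - (q : ℝ[X]), monic_X_pow_sub hqd, ?_, fun r hr => ?_⟩
  · refine natDegree_eq_of_degree_eq_some ?_
    rw [degree_sub_eq_left_of_degree_lt (by rwa [degree_X_pow]), degree_X_pow]
  · have h1 : L ((q : ℝ[X]) * r) = L (X ^ k * r) :=
      congrArg (fun φ : Module.Dual ℝ V => φ ⟨r, mem_degreeLT.2 hr⟩) hq
    have h2 : L (r * (X ^ k - (q : ℝ[X]))) = 0 := by
      rw [mul_comm, sub_mul, map_sub, h1, sub_self]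
    simpa only [hLapp, eval_mul] using h2

end OrthogonalPolynomials

section ProductMeasure

open MvPolynomial

variable {μ : Measure ℝ} [IsProbabilityMeasure μ] {n : ℕ}

lemma integrable_mvPolynomial_eval (hμ : ∀ k : ℕ, Integrable (fun x => x ^ k) μ)
    (f : MvPolynomial (Fin n) ℝ) :
    Integrable (fun x => eval x f) (Measure.pi fun _ : Fin n => μ) := by
  simp only [eval_eq']
  refine integrable_finsetSum _ fun m _ => Integrable.const_mul ?_ _
  exact Integrable.fintype_prod (f := fun i (x : ℝ) => x ^ m i) fun i => hμ (m i)

/-- Expectation of multivariate polynomials, as a linear functional. -/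
noncomputable def mvPolynomialExpectation (n : ℕ) (hμ : ∀ k : ℕ, Integrable (fun x => x ^ k) μ) :
    MvPolynomial (Fin n) ℝ →ₗ[ℝ] ℝ where
  toFun f := ∫ x, eval x f ∂(Measure.pi fun _ : Fin n => μ)
  map_add' f g := by
    simp only [map_add]
    exact integral_add (integrable_mvPolynomial_eval hμ f) (integrable_mvPolynomial_eval hμ g)
  map_smul' c f := by simp [integral_const_mul]

/-- The product `∏ i, p (I i) (X i)`. -/
noncomputable def tensorPolynomial (p : ℕ → Polynomial ℝ) (I : Fin n →₀ ℕ) :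
    MvPolynomial (Fin n) ℝ :=
  ∏ i, Polynomial.aeval (X i) (p (I i))

lemma eval_tensorPolynomial (p : ℕ → Polynomial ℝ) (I : Fin n →₀ ℕ) (x : Fin n → ℝ) :
    eval x (tensorPolynomial p I) = ∏ i, (p (I i)).eval (x i) := by
  rw [tensorPolynomial, map_prod]
  refine Finset.prod_congr rfl fun i _ => ?_
  rw [← MvPolynomial.coe_aeval_eq_eval, RingHom.coe_coe, ← Polynomial.aeval_algHom_apply,
    aeval_X, Polynomial.coe_aeval_eq_eval]

variable {p : ℕ → Polynomial ℝ}

lemma exists_lt_of_sum_le {I J : Fin n →₀ ℕ} (hne : J ≠ I) (hle : ∑ i, J i ≤ ∑ i, I i) :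
    ∃ i, J i < I i := by
  by_contra! h
  have heq := (Finset.sum_eq_sum_iff_of_le fun i _ => h i).1
    (le_antisymm (Finset.sum_le_sum fun i _ => h i) hle)
  exact hne (Finsupp.ext fun i => (heq i (Finset.mem_univ i)).symm)

lemma integral_monomial_mul_tensorPolynomial (I J : Fin n →₀ ℕ) (c : ℝ) :
    ∫ x, eval x (monomial J c * tensorPolynomial p I) ∂(Measure.pi fun _ : Fin n => μ) =
      c * ∏ i, ∫ t, t ^ J i * (p (I i)).eval t ∂μ := by
  rw [← integral_fintype_prod_eq_prod (fun i t => t ^ J i * (p (I i)).eval t),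
    ← integral_const_mul]
  refine integral_congr_ae (Filter.Eventually.of_forall fun x => ?_)
  simp only [map_mul, eval_tensorPolynomial, eval_monomial, Finset.prod_mul_distrib,
    Finsupp.prod_fintype _ _ fun _ => pow_zero _, mul_assoc]

lemma integral_tensorPolynomial_mul (I J : Fin n →₀ ℕ) :
    ∫ x, eval x (tensorPolynomial p J * tensorPolynomial p I)
      ∂(Measure.pi fun _ : Fin n => μ) =
      ∏ i, ∫ t, (p (J i)).eval t * (p (I i)).eval t ∂μ := by
  rw [← integral_fintype_prod_eq_prod (fun i t => (p (J i)).eval t * (p (I i)).eval t)]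
  simp only [map_mul, eval_tensorPolynomial, Finset.prod_mul_distrib]

/-- The variance of a polynomial dominates the contribution of its top degree part, expanded in
products of monic orthogonal polynomials. -/
lemma sum_sq_mul_prod_le_variance (hμ : ∀ q : Polynomial ℝ, Integrable (fun x => q.eval x) μ)
    (hmonic : ∀ k, (p k).Monic) (hdegree : ∀ k, (p k).natDegree = k)
    (horth : ∀ (k : ℕ) (r : Polynomial ℝ), r.degree < k → ∫ x, r.eval x * (p k).eval x ∂μ = 0)
    {d : ℕ} (hd : 0 < d) {f : MvPolynomial (Fin n) ℝ} (hf : f.totalDegree ≤ d) :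
    ∑ I ∈ f.support.filter (fun m => (∑ i, m i) = d),
        f.coeff I ^ 2 * ∏ i, ∫ t, (p (I i)).eval t ^ 2 ∂μ ≤
      (∫ x, (eval x f) ^ 2 ∂(Measure.pi fun _ : Fin n => μ)) -
        (∫ x, eval x f ∂(Measure.pi fun _ : Fin n => μ)) ^ 2 := by
  have hpow (k : ℕ) : Integrable (fun x : ℝ => x ^ k) μ := by
    simpa only [Polynomial.eval_pow, Polynomial.eval_X] using hμ (Polynomial.X ^ k)
  set E := mvPolynomialExpectation n hpow
  have hEapp (g : MvPolynomial (Fin n) ℝ) :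
      E g = ∫ x, eval x g ∂(Measure.pi fun _ : Fin n => μ) := rfl
  have hdeg (k : ℕ) : (p k).degree = k := by
    rw [Polynomial.degree_eq_natDegree (hmonic k).ne_zero, hdegree]
  set h : (Fin n →₀ ℕ) → ℝ := fun I => ∏ i, ∫ t, (p (I i)).eval t ^ 2 ∂μ with hh
  have hnorm (k : ℕ) : ∫ t, t ^ k * (p k).eval t ∂μ = ∫ t, (p k).eval t ^ 2 ∂μ := by
    have hlt : (Polynomial.X ^ k - p k).degree < (k : WithBot ℕ) := by
      have := Polynomial.degree_sub_lt_left (p := Polynomial.X ^ k) (q := p k)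
        (by rw [hdeg, Polynomial.degree_X_pow]) (pow_ne_zero _ Polynomial.X_ne_zero)
        (by rw [(hmonic k).leadingCoeff, Polynomial.leadingCoeff_X_pow])
      rwa [Polynomial.degree_X_pow] at this
    have h0 := horth k _ hlt
    simp only [Polynomial.eval_sub, Polynomial.eval_pow, Polynomial.eval_X, sub_mul] at h0
    have i1 := hμ (Polynomial.X ^ k * p k)
    have i2 := hμ (p k * p k)
    simp only [Polynomial.eval_mul, Polynomial.eval_pow, Polynomial.eval_X] at i1 i2
    rw [integral_sub i1 i2] at h0
    simp only [sq]
    linarith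
  have hmon (I J : Fin n →₀ ℕ) (c : ℝ) (hlt : ∃ i, J i < I i) :
      E (monomial J c * tensorPolynomial p I) = 0 := by
    obtain ⟨i, hi⟩ := hlt
    rw [hEapp, integral_monomial_mul_tensorPolynomial, Finset.prod_eq_zero (Finset.mem_univ i),
      mul_zero]
    have := horth (I i) (Polynomial.X ^ J i) (by
      rw [Polynomial.degree_X_pow]
      exact_mod_cast hi)
    simpa using this
  have hfP (I : Fin n →₀ ℕ) (hI : ∑ i, I i = d) :
      E (f * tensorPolynomial p I) = f.coeff I * h I := by
    conv_lhs => rw [f.as_sum, Finset.sum_mul, map_sum]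
    rw [Finset.sum_eq_single I]
    · rw [hEapp, integral_monomial_mul_tensorPolynomial]
      simp only [hnorm, hh]
    · intro J hJ hne
      refine hmon I J _ (exists_lt_of_sum_le hne ?_)
      rw [hI]
      have := (le_totalDegree hJ).trans hf
      rwa [Finsupp.sum_fintype _ _ fun _ => rfl] at this
    · intro hI'
      simp [notMem_support_iff.1 hI']
  have hP (I : Fin n →₀ ℕ) (hI : ∑ i, I i = d) : E (tensorPolynomial p I) = 0 := by
    have hne : (0 : Fin n →₀ ℕ) ≠ I := by
      rintro rfl
      simp at hI
      omega
    have := hmon I 0 1 (exists_lt_of_sum_le hne (by simp))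
    simpa using this
  have hPP (I J : Fin n →₀ ℕ) (hI : ∑ i, I i = d) (hJ : ∑ i, J i = d) (hne : J ≠ I) :
      E (tensorPolynomial p J * tensorPolynomial p I) = 0 := by
    obtain ⟨i, hi⟩ := exists_lt_of_sum_le hne (by rw [hI, hJ])
    rw [hEapp, integral_tensorPolynomial_mul]
    refine Finset.prod_eq_zero (Finset.mem_univ i) (horth _ _ ?_)
    rw [hdeg]
    exact_mod_cast hi
  have hPI (I : Fin n →₀ ℕ) : E (tensorPolynomial p I * tensorPolynomial p I) = h I := by
    rw [hEapp, integral_tensorPolynomial_mul]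
    simp only [hh, sq]
  set A := f.support.filter (fun m => (∑ i, m i) = d)
  have hAd (I : Fin n →₀ ℕ) (hI : I ∈ A) : ∑ i, I i = d := (Finset.mem_filter.1 hI).2
  set Q : MvPolynomial (Fin n) ℝ := ∑ I ∈ A, f.coeff I • tensorPolynomial p I with hQ
  have hEQ : E Q = 0 := by
    rw [hQ, map_sum]
    exact Finset.sum_eq_zero fun I hI => by rw [map_smul, hP I (hAd I hI), smul_zero]
  have hEfQ : E (f * Q) = ∑ I ∈ A, f.coeff I ^ 2 * h I := by
    rw [hQ, Finset.mul_sum, map_sum]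
    refine Finset.sum_congr rfl fun I hI => ?_
    rw [mul_smul_comm, map_smul, hfP I (hAd I hI), smul_eq_mul]
    ring
  have hEQQ : E (Q * Q) = ∑ I ∈ A, f.coeff I ^ 2 * h I := by
    conv_lhs => rw [hQ, Finset.mul_sum, map_sum]
    refine Finset.sum_congr rfl fun I hI => ?_
    rw [mul_smul_comm, map_smul, Finset.sum_mul, map_sum, Finset.sum_eq_single I]
    · rw [smul_mul_assoc, map_smul, hPI, smul_eq_mul, smul_eq_mul]
      ring
    · intro J hJ hne
      rw [smul_mul_assoc, map_smul, hPP I J (hAd I hI) (hAd J hJ) hne, smul_zero]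
    · exact fun hI' => absurd hI hI'
  have hE1 : E 1 = 1 := by simp [hEapp]
  have hnonneg : 0 ≤ E ((f - C (E f) - Q) ^ 2) := by
    rw [hEapp]
    exact integral_nonneg fun x => by
      simp only [map_pow]
      positivity
  have hexpand : (f - C (E f) - Q) ^ 2 =
      f ^ 2 - (2 * E f) • f + (E f ^ 2) • 1 - (2 : ℝ) • (f * Q) + (2 * E f) • Q + Q * Q := by
    simp only [smul_eq_C_mul, map_mul, map_pow, map_ofNat]
    ring
  rw [hexpand] at hnonneg
  simp only [map_add, map_sub, map_smul, smul_eq_mul, hEfQ, hEQQ, hEQ, hE1] at hnonneg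
  have hsq : E (f ^ 2) = ∫ x, (eval x f) ^ 2 ∂(Measure.pi fun _ : Fin n => μ) := by
    simp only [hEapp, map_pow]
  rw [← hsq, ← hEapp]
  nlinarith

end ProductMeasure

/-- isotropic log-concave product measures, explicit variance bound. -/
theorem stmt1 (μ : Measure ℝ) [IsProbabilityMeasure μ]
    (hlc : IsLogConcaveMeasure μ)
    (hmean : ∫ x, x ∂μ = 0) (hvar : ∫ x, x ^ 2 ∂μ = 1)
    (d : ℕ) (hd : 0 < d) (n : ℕ) (f : MvPolynomial (Fin n) ℝ)
    (hdeg : f.totalDegree ≤ d) :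
    (∫ x, (MvPolynomial.eval x f) ^ 2 ∂(Measure.pi fun _ : Fin n => μ)) -
        (∫ x, MvPolynomial.eval x f ∂(Measure.pi fun _ : Fin n => μ)) ^ 2 ≥
      (1 / 2 ^ (15 * d)) * coeffd d f ^ 2 := by
  have hpos (q : Polynomial ℝ) (hq : q.Monic) : 0 < ∫ x, q.eval x ^ 2 ∂μ :=
    lt_of_lt_of_le (by positivity) (hq.le_integral_sq hlc hmean hvar)
  choose p hmonic hdegree horth using exists_monic_orthogonal hlc.integrable_eval hpos
  refine ge_iff_le.2 (le_trans ?_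
    (sum_sq_mul_prod_le_variance hlc.integrable_eval hmonic hdegree horth hd hdeg))
  rw [coeffd, Real.sq_sqrt (Finset.sum_nonneg fun _ _ => sq_nonneg _), Finset.mul_sum]
  refine Finset.sum_le_sum fun I hI => ?_
  rw [mul_comm]
  refine mul_le_mul_of_nonneg_left ?_ (sq_nonneg _)
  calc (1 / 2 ^ (15 * d) : ℝ) = ∏ i, (1 / 2 ^ 15 : ℝ) ^ I i := by
        rw [Finset.prod_pow_eq_pow_sum, (Finset.mem_filter.1 hI).2, div_pow, one_pow, ← pow_mul]
    _ ≤ ∏ i, ∫ t, (p (I i)).eval t ^ 2 ∂μ := by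
        refine Finset.prod_le_prod (fun _ _ => by positivity) fun i _ => ?_
        simpa only [hdegree] using (hmonic (I i)).le_integral_sq hlc hmean hvar
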